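/- Let N and n be positive integers and, for each i ∈ {1, …, n}, let cᵢ : ℝᴺ → ℝᴺ be a bijection whose inverse cᵢ⁻¹ is Lipschitz continuous with constant L ≥ 0 (with respect to the Euclidean norm). Let h₁, …, hₙ ∈ ℝᴺ, set zᵢ = cᵢ(hᵢ), and let z̄ = (1/n) Σᵢ zᵢ be the latent center. Suppose δ ≥ 0 is such that ‖cᵢ⁻¹(z) − cⱼ⁻¹(z)‖₂ ≤ δ for all i, j and all z ∈ ℝᴺ. Then for every pair of indices i, j, ‖hᵢ − hⱼ‖₂ ≤ L · (‖zᵢ − z̄‖₂ + ‖zⱼ − z̄‖₂) + δ; in particular, ‖hᵢ − hⱼ‖₂ ≤ L · L_align(center) + δ, where L_align(center) = Σ_{k=1}^{n} ‖z_k − z̄‖₂ is the center-based alignment loss. -/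

import Mathlib

/-- If two Lipschitz maps differ by at most `δ` at `w`, then their values at `x` and `y` differ by
at most `K` times the length of the path from `x` to `y` through `w`, plus `δ`. -/
theorem LipschitzWith.norm_sub_le_of_norm_sub_le {E F : Type*} [SeminormedAddCommGroup E]
    [SeminormedAddCommGroup F] {K : NNReal} {f g : E → F} (hf : LipschitzWith K f)
    (hg : LipschitzWith K g) {w : E} {δ : ℝ} (hfg : ‖f w - g w‖ ≤ δ) (x y : E) :
    ‖f x - g y‖ ≤ K * (‖x - w‖ + ‖y - w‖) + δ := by
  have hfx := hf.dist_le_mul x w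
  have hgy := hg.dist_le_mul w y
  have htri := dist_triangle4 (f x) (f w) (g w) (g y)
  rw [dist_comm w y] at hgy
  simp only [dist_eq_norm] at hfx hgy htri
  linarith

/-- n-task version of Lemma 1 (Bounded Feature Discrepancy) under the
center-based alignment objective: for all pairs of tasks `i, j`,
`‖hᵢ − hⱼ‖ ≤ L·(‖zᵢ − z̄‖ + ‖zⱼ − z̄‖) + δ`, and in particular
`‖hᵢ − hⱼ‖ ≤ L · L_align(center) + δ` where
`L_align(center) = Σₖ ‖zₖ − z̄‖`. -/
theorem bounded_feature_discrepancy_center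
    (N n : ℕ) (hN : 0 < N) (hn : 0 < n)
    (c cinv : Fin n → (EuclideanSpace ℝ (Fin N) → EuclideanSpace ℝ (Fin N)))
    (hc : ∀ i, Function.Bijective (c i))
    (hcleft : ∀ i, Function.LeftInverse (cinv i) (c i))
    (hcright : ∀ i, Function.RightInverse (cinv i) (c i))
    (L : ℝ) (hL : 0 ≤ L)
    (hLip : ∀ i, LipschitzWith L.toNNReal (cinv i))
    (h z : Fin n → EuclideanSpace ℝ (Fin N))
    (hz : ∀ i, z i = c i (h i))
    (zbar : EuclideanSpace ℝ (Fin N))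
    (hzbar : zbar = (1 / (n : ℝ)) • ∑ i, z i)
    (δ : ℝ) (hδ : 0 ≤ δ)
    (hδbound : ∀ i j, ∀ w : EuclideanSpace ℝ (Fin N),
      ‖cinv i w - cinv j w‖ ≤ δ)
    (Lalign : ℝ) (hLalign : Lalign = ∑ k, ‖z k - zbar‖) :
    ∀ i j,
      ‖h i - h j‖ ≤ L * (‖z i - zbar‖ + ‖z j - zbar‖) + δ ∧
      ‖h i - h j‖ ≤ L * Lalign + δ := by
  intro i j
  have hinv k : cinv k (z k) = h k := by rw [hz, hcleft]
  have hpair : ‖h i - h j‖ ≤ L * (‖z i - zbar‖ + ‖z j - zbar‖) + δ := by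
    simpa only [hinv, Real.coe_toNNReal L hL] using
      (hLip i).norm_sub_le_of_norm_sub_le (hLip j) (hδbound i j zbar) (z i) (z j)
  refine ⟨hpair, ?_⟩
  rcases eq_or_ne i j with rfl | hij
  · rw [sub_self, norm_zero, hLalign]
    positivity
  · have hsum : ‖z i - zbar‖ + ‖z j - zbar‖ ≤ Lalign := by
      rw [hLalign]
      exact Finset.add_le_sum (f := fun k => ‖z k - zbar‖) (fun _ _ => norm_nonneg _)
        (Finset.mem_univ i) (Finset.mem_univ j) hij
    exact hpair.trans (by gcongr)
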